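/- For every m with 1 ≤ m ≤ M, the graph G_m produced by the (deterministic) König acceptance rule contains a maximum matching M* such that every edge e_i with 1 ≤ i ≤ m shares at least one vertex with the set of vertices covered by M*. -/

import Mathlib

open scoped Classical

noncomputable section

/-- `M` is a matching in the graph `G`: a set of edges of `G` that are pairwise disjoint. -/
def IsMatchingOn {n : ℕ} (G : SimpleGraph (Fin n)) (M : Finset (Sym2 (Fin n))) : Prop :=
  (∀ e ∈ M, e ∈ G.edgeSet) ∧
  ∀ e ∈ M, ∀ f ∈ M, e ≠ f → ∀ v : Fin n, v ∈ e → v ∉ f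

/-- ν(G): the maximum size of a matching of `G`. -/
def matchNum {n : ℕ} (G : SimpleGraph (Fin n)) : ℕ :=
  sSup {k | ∃ M : Finset (Sym2 (Fin n)), IsMatchingOn G M ∧ M.card = k}

/-- `C` is a vertex cover of `G`. -/
def IsVertexCover {n : ℕ} (G : SimpleGraph (Fin n)) (C : Finset (Fin n)) : Prop :=
  ∀ e ∈ G.edgeSet, ∃ v ∈ C, v ∈ e

/-- τ(G): the minimum size of a vertex cover of `G`. -/
def coverNum {n : ℕ} (G : SimpleGraph (Fin n)) : ℕ :=
  sInf {k | ∃ C : Finset (Fin n), IsVertexCover G C ∧ C.card = k}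

/-- `G` is a König graph: ν(G) = τ(G). -/
def IsKonig {n : ℕ} (G : SimpleGraph (Fin n)) : Prop := matchNum G = coverNum G

/-- The deterministic König process driven by an arbitrary sequence of vertex pairs:
`KonigProcSeq e m` is `G_m`, where the pair `e i` (0-indexed) plays the role of `e_{i+1}`. -/
def KonigProcSeq {n : ℕ} (e : ℕ → Sym2 (Fin n)) : ℕ → SimpleGraph (Fin n)
  | 0 => ⊥
  | m+1 =>
    if IsKonig (KonigProcSeq e m ⊔ SimpleGraph.fromEdgeSet {e m})
      then KonigProcSeq e m ⊔ SimpleGraph.fromEdgeSet {e m}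
      else KonigProcSeq e m

section Matchings

variable {n : ℕ}

theorem IsMatchingOn.mono {G H : SimpleGraph (Fin n)} (h : G ≤ H) {M : Finset (Sym2 (Fin n))}
    (hM : IsMatchingOn G M) : IsMatchingOn H M :=
  ⟨fun e he => SimpleGraph.edgeSet_mono h (hM.1 e he), hM.2⟩

theorem bddAbove_card_matchings (G : SimpleGraph (Fin n)) :
    BddAbove {k | ∃ M : Finset (Sym2 (Fin n)), IsMatchingOn G M ∧ M.card = k} :=
  ⟨Fintype.card (Sym2 (Fin n)), by rintro _ ⟨M, -, rfl⟩; exact M.card_le_univ⟩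

theorem IsMatchingOn.card_le_matchNum {G : SimpleGraph (Fin n)} {M : Finset (Sym2 (Fin n))}
    (hM : IsMatchingOn G M) : M.card ≤ matchNum G :=
  le_csSup (bddAbove_card_matchings G) ⟨M, hM, rfl⟩

theorem isMatchingOn_empty (G : SimpleGraph (Fin n)) : IsMatchingOn G ∅ := by
  simp [IsMatchingOn]

theorem exists_isMatchingOn_card_eq_matchNum (G : SimpleGraph (Fin n)) :
    ∃ M, IsMatchingOn G M ∧ M.card = matchNum G :=
  Nat.sSup_mem
    (s := {k | ∃ M : Finset (Sym2 (Fin n)), IsMatchingOn G M ∧ M.card = k})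
    ⟨0, ∅, isMatchingOn_empty G, rfl⟩ (bddAbove_card_matchings G)

theorem exists_isVertexCover_card_eq_coverNum (G : SimpleGraph (Fin n)) :
    ∃ C, IsVertexCover G C ∧ C.card = coverNum G := by
  refine Nat.sInf_mem (s := {k | ∃ C : Finset (Fin n), IsVertexCover G C ∧ C.card = k})
    ⟨_, Finset.univ, fun e _ => ?_, rfl⟩
  induction e with
  | h a b => exact ⟨a, Finset.mem_univ a, Sym2.mem_mk_left a b⟩

theorem IsVertexCover.coverNum_le_card {G : SimpleGraph (Fin n)} {C : Finset (Fin n)}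
    (hC : IsVertexCover G C) : coverNum G ≤ C.card :=
  Nat.sInf_le ⟨C, hC, rfl⟩

theorem matchNum_le_coverNum (G : SimpleGraph (Fin n)) : matchNum G ≤ coverNum G := by
  obtain ⟨M, hM, hMcard⟩ := exists_isMatchingOn_card_eq_matchNum G
  obtain ⟨C, hC, hCcard⟩ := exists_isVertexCover_card_eq_coverNum G
  rw [← hMcard, ← hCcard]
  refine Finset.card_le_card_of_forall_subsingleton (fun f v => v ∈ f)
    (fun f hf => hC f (hM.1 f hf)) fun v _ f hf g hg => ?_
  by_contra hne
  exact hM.2 f hf.1 g hg.1 hne v hf.2 hg.2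

theorem coverNum_sup_edge_le (G : SimpleGraph (Fin n)) (e : Sym2 (Fin n)) :
    coverNum (G ⊔ SimpleGraph.fromEdgeSet {e}) ≤ coverNum G + 1 := by
  obtain ⟨C, hC, hCcard⟩ := exists_isVertexCover_card_eq_coverNum G
  obtain ⟨a, ha⟩ : ∃ a, a ∈ e := ⟨_, Sym2.out_fst_mem e⟩
  have hcover : IsVertexCover (G ⊔ SimpleGraph.fromEdgeSet {e}) (insert a C) := by
    intro f hf
    rw [SimpleGraph.edgeSet_sup, SimpleGraph.edgeSet_fromEdgeSet] at hf
    rcases hf with hf | hf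
    · obtain ⟨v, hv, hvf⟩ := hC f hf
      exact ⟨v, Finset.mem_insert_of_mem hv, hvf⟩
    · obtain rfl : f = e := hf.1
      exact ⟨a, Finset.mem_insert_self a C, ha⟩
  exact hcover.coverNum_le_card.trans (hCcard ▸ Finset.card_insert_le a C)

theorem isKonig_bot : IsKonig (⊥ : SimpleGraph (Fin n)) := by
  refine (matchNum_le_coverNum _).antisymm ?_
  have hcover : IsVertexCover (⊥ : SimpleGraph (Fin n)) ∅ := by simp [IsVertexCover]
  exact hcover.coverNum_le_card.trans (Nat.zero_le _)

theorem isKonig_konigProcSeq (e : ℕ → Sym2 (Fin n)) (m : ℕ) : IsKonig (KonigProcSeq e m) := by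
  induction m with
  | zero => exact isKonig_bot
  | succ m ih =>
    rw [KonigProcSeq]
    split_ifs with h
    exacts [h, ih]

theorem IsMatchingOn.insert_edge {G : SimpleGraph (Fin n)} {M : Finset (Sym2 (Fin n))}
    (hM : IsMatchingOn G M) {e : Sym2 (Fin n)} (he : e ∈ G.edgeSet)
    (hdisj : ∀ v ∈ e, ∀ f ∈ M, v ∉ f) : IsMatchingOn G (insert e M) := by
  refine ⟨fun f hf => ?_, fun f hf g hg hne v hvf hvg => ?_⟩
  · rcases Finset.mem_insert.1 hf with rfl | hf
    exacts [he, hM.1 f hf]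
  · rcases Finset.mem_insert.1 hf with rfl | hfM <;> rcases Finset.mem_insert.1 hg with rfl | hgM
    exacts [hne rfl, hdisj v hvf g hgM hvg, hdisj v hvg f hfM hvf,
      hM.2 f hfM g hgM hne v hvf hvg]

theorem card_insert_of_forall_notMem {M : Finset (Sym2 (Fin n))} {e : Sym2 (Fin n)}
    (hdisj : ∀ v ∈ e, ∀ f ∈ M, v ∉ f) : (insert e M).card = M.card + 1 :=
  Finset.card_insert_of_notMem fun he =>
    hdisj _ (Sym2.out_fst_mem e) e he (Sym2.out_fst_mem e)

/-- An edge is met by every maximum matching. -/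
theorem IsMatchingOn.exists_mem_of_card_eq {G : SimpleGraph (Fin n)} {M : Finset (Sym2 (Fin n))}
    (hM : IsMatchingOn G M) (hcard : M.card = matchNum G) {e : Sym2 (Fin n)}
    (he : e ∈ G.edgeSet) : ∃ v ∈ e, ∃ f ∈ M, v ∈ f := by
  by_contra! hdisj
  have := (hM.insert_edge he hdisj).card_le_matchNum
  rw [card_insert_of_forall_notMem hdisj] at this
  omega

/-- If adding a pair destroys the König property, the pair is met by every maximum matching. -/
theorem IsMatchingOn.exists_mem_of_not_isKonig {G : SimpleGraph (Fin n)}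
    {M : Finset (Sym2 (Fin n))} (hM : IsMatchingOn G M) (hcard : M.card = matchNum G)
    (hG : IsKonig G) {e : Sym2 (Fin n)} (he : ¬ e.IsDiag)
    (hGe : ¬ IsKonig (G ⊔ SimpleGraph.fromEdgeSet {e})) : ∃ v ∈ e, ∃ f ∈ M, v ∈ f := by
  by_contra! hdisj
  refine hGe ((matchNum_le_coverNum _).antisymm ?_)
  have hmem : e ∈ (G ⊔ SimpleGraph.fromEdgeSet {e}).edgeSet := by
    rw [SimpleGraph.edgeSet_sup, SimpleGraph.edgeSet_fromEdgeSet]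
    exact Or.inr ⟨rfl, he⟩
  have hmatch := ((hM.mono le_sup_left).insert_edge hmem hdisj).card_le_matchNum
  rw [card_insert_of_forall_notMem hdisj, hcard, hG] at hmatch
  exact (coverNum_sup_edge_le G e).trans hmatch

/-- The vertices covered by a matching are covered by some maximum matching: a maximum matching
sharing as many edges as possible with the given one will do. -/
theorem IsMatchingOn.exists_maximum_covering {G : SimpleGraph (Fin n)}
    {M : Finset (Sym2 (Fin n))} (hM : IsMatchingOn G M) :
    ∃ N, IsMatchingOn G N ∧ N.card = matchNum G ∧
      ∀ v, (∃ f ∈ M, v ∈ f) → ∃ f ∈ N, v ∈ f := by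
  obtain ⟨N₀, hN₀⟩ := exists_isMatchingOn_card_eq_matchNum G
  obtain ⟨N, hN, hmax⟩ := Finset.exists_max_image
    (Finset.univ.filter fun N => IsMatchingOn G N ∧ N.card = matchNum G)
    (fun N => (N ∩ M).card) ⟨N₀, by simpa using hN₀⟩
  simp only [Finset.mem_filter, Finset.mem_univ, true_and] at hN hmax
  obtain ⟨hN, hcard⟩ := hN
  refine ⟨N, hN, hcard, ?_⟩
  rintro v ⟨f, hf, hvf⟩
  by_contra! hv
  obtain ⟨w, hwf, g, hg, hwg⟩ := hN.exists_mem_of_card_eq hcard (hM.1 f hf)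
  have hfN : f ∉ N := fun h => hv f h hvf
  have hgM : g ∉ M := fun h => hM.2 f hf g h (fun hfg => hfN (hfg ▸ hg)) w hwf hwg
  have hvw : v ≠ w := fun h => hv g hg (h ▸ hwg)
  have hfvw : f = s(v, w) := (Sym2.mem_and_mem_iff hvw).1 ⟨hvf, hwf⟩
  have hdisj : ∀ x ∈ f, ∀ k ∈ N.erase g, x ∉ k := by
    intro x hx k hk hxk
    rw [Finset.mem_erase] at hk
    rw [hfvw, Sym2.mem_iff] at hx
    rcases hx with rfl | rfl
    exacts [hv k hk.2 hxk, hN.2 k hk.2 g hg hk.1 x hxk hwg]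
  have herase : IsMatchingOn G (N.erase g) :=
    ⟨fun k hk => hN.1 k (Finset.mem_of_mem_erase hk), fun k hk l hl =>
      hN.2 k (Finset.mem_of_mem_erase hk) l (Finset.mem_of_mem_erase hl)⟩
  have hle := hmax (insert f (N.erase g)) ⟨herase.insert_edge (hM.1 f hf) hdisj, by
    rw [card_insert_of_forall_notMem hdisj, Finset.card_erase_add_one hg, hcard]⟩
  rw [Finset.insert_inter_of_mem hf, Finset.erase_inter, Finset.erase_eq_of_notMem (by simp [hgM]),
    Finset.card_insert_of_notMem (by simp [hfN])] at hle
  omega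

end Matchings

/-- For all `1 ≤ m ≤ M`, the graph `G_m` of the König process has a maximum matching `M*`
such that every offered pair `e_1, …, e_m` shares a vertex with the vertex set of `M*`. -/
theorem koenig_process_max_matching_meets_all_offered_edges
    {n M : ℕ} (e : ℕ → Sym2 (Fin n))
    (hdiag : ∀ i < M, ¬ (e i).IsDiag)
    (hdist : ∀ i < M, ∀ j < M, i ≠ j → e i ≠ e j)
    (m : ℕ) (hm1 : 1 ≤ m) (hmM : m ≤ M) :
    ∃ Mstar : Finset (Sym2 (Fin n)),
      IsMatchingOn (KonigProcSeq e m) Mstar ∧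
      Mstar.card = matchNum (KonigProcSeq e m) ∧
      ∀ i < m, ∃ v : Fin n, v ∈ e i ∧ ∃ f ∈ Mstar, v ∈ f := by
  clear hm1 hdist
  induction m with
  | zero =>
    obtain ⟨N, hN, hcard⟩ := exists_isMatchingOn_card_eq_matchNum (KonigProcSeq e 0)
    exact ⟨N, hN, hcard, by simp⟩
  | succ m ih =>
    obtain ⟨N, hN, hcard, hmeet⟩ := ih (by omega)
    have hem : ¬ (e m).IsDiag := hdiag m (by omega)
    rw [KonigProcSeq]
    split_ifs with h
    · obtain ⟨N', hN', hcard', hcover⟩ := (hN.mono le_sup_left :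
        IsMatchingOn (KonigProcSeq e m ⊔ SimpleGraph.fromEdgeSet {e m}) N).exists_maximum_covering
      refine ⟨N', hN', hcard', fun i hi => ?_⟩
      rcases Nat.lt_succ_iff_lt_or_eq.1 hi with hi | rfl
      · obtain ⟨v, hv, hvN⟩ := hmeet i hi
        exact ⟨v, hv, hcover v hvN⟩
      · refine hN'.exists_mem_of_card_eq hcard' ?_
        rw [SimpleGraph.edgeSet_sup, SimpleGraph.edgeSet_fromEdgeSet]
        exact Or.inr ⟨rfl, hem⟩
    · refine ⟨N, hN, hcard, fun i hi => ?_⟩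
      rcases Nat.lt_succ_iff_lt_or_eq.1 hi with hi | rfl
      · exact hmeet i hi
      · exact hN.exists_mem_of_not_isKonig hcard (isKonig_konigProcSeq e i) hem h
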